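/- Let u : ℝ³ → ℝ be a smooth function of (x, y, t) and let λ ∈ ℝ with λ ≠ 0 and λ ≠ −1. Set A = (λ+1)⁻¹ u_t and B = λ⁻¹ u_y. Then the compatibility condition of the system q_t = A q_x, q_y = B q_x, namely ∂_y A + A ∂_x B = ∂_t B + B ∂_x A, holds at every point of ℝ³ if and only if u satisfies the modified Veronese web equation u_ty = u_t u_xy − u_y u_tx at every point. (Hence q_t = (λ+1)⁻¹ u_t q_x, q_y = λ⁻¹ u_y q_x is a Lax pair for the modified Veronese web equation.) -/

import Mathlib

noncomputable section

/-- Partial derivative with respect to the first variable (`x`). -/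
def Dx (f : ℝ → ℝ → ℝ → ℝ) (x y t : ℝ) : ℝ := deriv (fun x' => f x' y t) x

/-- Partial derivative with respect to the second variable (`y`). -/
def Dy (f : ℝ → ℝ → ℝ → ℝ) (x y t : ℝ) : ℝ := deriv (fun y' => f x y' t) y

/-- Partial derivative with respect to the third variable (`t`). -/
def Dt (f : ℝ → ℝ → ℝ → ℝ) (x y t : ℝ) : ℝ := deriv (fun t' => f x y t') t

/-- Smoothness of a function of three real variables `(x, y, t)`. -/
def Smooth3 (f : ℝ → ℝ → ℝ → ℝ) : Prop :=
  ContDiff ℝ (⊤ : ℕ∞) (fun p : ℝ × ℝ × ℝ => f p.1 p.2.1 p.2.2)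

lemma Dx_eq_fderiv {f : ℝ → ℝ → ℝ → ℝ}
    (hf : Differentiable ℝ fun p : ℝ × ℝ × ℝ => f p.1 p.2.1 p.2.2) (x y t : ℝ) :
    Dx f x y t = fderiv ℝ (fun p : ℝ × ℝ × ℝ => f p.1 p.2.1 p.2.2) (x, y, t) (1, 0, 0) :=
  (HasFDerivAt.comp_hasDerivAt (f := fun x' => (x', y, t)) x (hf (x, y, t)).hasFDerivAt
    ((hasDerivAt_id x).prodMk ((hasDerivAt_const x y).prodMk (hasDerivAt_const x t)))).deriv

lemma Dy_eq_fderiv {f : ℝ → ℝ → ℝ → ℝ}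
    (hf : Differentiable ℝ fun p : ℝ × ℝ × ℝ => f p.1 p.2.1 p.2.2) (x y t : ℝ) :
    Dy f x y t = fderiv ℝ (fun p : ℝ × ℝ × ℝ => f p.1 p.2.1 p.2.2) (x, y, t) (0, 1, 0) :=
  (HasFDerivAt.comp_hasDerivAt (f := fun y' => (x, y', t)) y (hf (x, y, t)).hasFDerivAt
    ((hasDerivAt_const y x).prodMk ((hasDerivAt_id y).prodMk (hasDerivAt_const y t)))).deriv

lemma Dt_eq_fderiv {f : ℝ → ℝ → ℝ → ℝ}
    (hf : Differentiable ℝ fun p : ℝ × ℝ × ℝ => f p.1 p.2.1 p.2.2) (x y t : ℝ) :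
    Dt f x y t = fderiv ℝ (fun p : ℝ × ℝ × ℝ => f p.1 p.2.1 p.2.2) (x, y, t) (0, 0, 1) :=
  (HasFDerivAt.comp_hasDerivAt (f := fun t' => (x, y, t')) t (hf (x, y, t)).hasFDerivAt
    ((hasDerivAt_const t x).prodMk ((hasDerivAt_const t y).prodMk (hasDerivAt_id t)))).deriv

lemma Smooth3.differentiable {f : ℝ → ℝ → ℝ → ℝ} (hf : Smooth3 f) :
    Differentiable ℝ fun p : ℝ × ℝ × ℝ => f p.1 p.2.1 p.2.2 :=
  ContDiff.differentiable hf (by simp)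

lemma Smooth3.differentiable_fderiv_apply {f : ℝ → ℝ → ℝ → ℝ} (hf : Smooth3 f)
    (v : ℝ × ℝ × ℝ) :
    Differentiable ℝ fun p => fderiv ℝ (fun p : ℝ × ℝ × ℝ => f p.1 p.2.1 p.2.2) p v :=
  ((ContDiff.fderiv_right (m := 1) hf (by norm_cast)).differentiable (by simp)).clm_apply
    (differentiable_const v)

/-- Directional derivatives of a smooth function of three variables commute. -/
lemma Smooth3.fderiv_fderiv_apply_comm {f : ℝ → ℝ → ℝ → ℝ} (hf : Smooth3 f)
    (p v w : ℝ × ℝ × ℝ) :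
    fderiv ℝ (fun q => fderiv ℝ (fun p : ℝ × ℝ × ℝ => f p.1 p.2.1 p.2.2) q v) p w =
      fderiv ℝ (fun q => fderiv ℝ (fun p : ℝ × ℝ × ℝ => f p.1 p.2.1 p.2.2) q w) p v := by
  have hd : Differentiable ℝ (fderiv ℝ fun p : ℝ × ℝ × ℝ => f p.1 p.2.1 p.2.2) :=
    (ContDiff.fderiv_right (m := 1) hf (by norm_cast)).differentiable (by simp)
  have hsymm : IsSymmSndFDerivAt ℝ (fun p : ℝ × ℝ × ℝ => f p.1 p.2.1 p.2.2) p :=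
    (ContDiff.contDiffAt hf).isSymmSndFDerivAt
      (by rw [minSmoothness_of_isRCLikeNormedField]; exact WithTop.coe_le_coe.2 (le_top : (2 : ℕ∞) ≤ ⊤))
  rw [fderiv_clm_apply (hd p) (differentiableAt_const v),
    fderiv_clm_apply (hd p) (differentiableAt_const w)]
  simpa using hsymm.eq w v

lemma Smooth3.Dy_Dt_comm {f : ℝ → ℝ → ℝ → ℝ} (hf : Smooth3 f) (x y t : ℝ) :
    Dy (Dt f) x y t = Dt (Dy f) x y t := by
  have ht := funext fun x => funext fun y => funext (Dt_eq_fderiv hf.differentiable x y)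
  have hy := funext fun x => funext fun y => funext (Dy_eq_fderiv hf.differentiable x y)
  rw [ht, hy, Dy_eq_fderiv (hf.differentiable_fderiv_apply _),
    Dt_eq_fderiv (hf.differentiable_fderiv_apply _)]
  exact hf.fderiv_fderiv_apply_comm _ _ _

lemma Smooth3.Dx_Dt_comm {f : ℝ → ℝ → ℝ → ℝ} (hf : Smooth3 f) (x y t : ℝ) :
    Dx (Dt f) x y t = Dt (Dx f) x y t := by
  have ht := funext fun x => funext fun y => funext (Dt_eq_fderiv hf.differentiable x y)
  have hx := funext fun x => funext fun y => funext (Dx_eq_fderiv hf.differentiable x y)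
  rw [ht, hx, Dx_eq_fderiv (hf.differentiable_fderiv_apply _),
    Dt_eq_fderiv (hf.differentiable_fderiv_apply _)]
  exact hf.fderiv_fderiv_apply_comm _ _ _

lemma Dx_const_mul (c : ℝ) (f : ℝ → ℝ → ℝ → ℝ) (x y t : ℝ) :
    Dx (fun x y t => c * f x y t) x y t = c * Dx f x y t :=
  deriv_const_mul_field c

lemma Dy_const_mul (c : ℝ) (f : ℝ → ℝ → ℝ → ℝ) (x y t : ℝ) :
    Dy (fun x y t => c * f x y t) x y t = c * Dy f x y t :=
  deriv_const_mul_field c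

lemma Dt_const_mul (c : ℝ) (f : ℝ → ℝ → ℝ → ℝ) (x y t : ℝ) :
    Dt (fun x y t => c * f x y t) x y t = c * Dt f x y t :=
  deriv_const_mul_field c

/-- The system `q_t = (λ+1)⁻¹ u_t q_x`, `q_y = λ⁻¹ u_y q_x` is compatible iff `u` solves
the modified Veronese web equation `u_ty = u_t u_xy - u_y u_tx`. -/
theorem mvwe_lax_pair_compatibility
    (u : ℝ → ℝ → ℝ → ℝ) (hu : Smooth3 u) (lam : ℝ) (hlam0 : lam ≠ 0) (hlam1 : lam ≠ -1)
    (A B : ℝ → ℝ → ℝ → ℝ)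
    (hA : A = fun x y t => (lam + 1)⁻¹ * Dt u x y t)
    (hB : B = fun x y t => lam⁻¹ * Dy u x y t) :
    (∀ x y t : ℝ,
      Dy A x y t + A x y t * Dx B x y t = Dt B x y t + B x y t * Dx A x y t) ↔
    (∀ x y t : ℝ, Dt (Dy u) x y t = Dt u x y t * Dx (Dy u) x y t - Dy u x y t * Dt (Dx u) x y t) := by
  have hlam1' : lam + 1 ≠ 0 := fun h => hlam1 (eq_neg_of_add_eq_zero_left h)
  subst hA hB
  refine forall_congr' fun x => forall_congr' fun y => forall_congr' fun t => ?_
  rw [Dx_const_mul, Dx_const_mul, Dy_const_mul, Dt_const_mul, hu.Dy_Dt_comm, hu.Dx_Dt_comm]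
  field_simp
  constructor <;> intro h <;> linarith
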